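/- Let (R, m) be a commutative Noetherian local ring with depth R ≥ 1, and let M, N be finitely generated Tor-independent R-modules with depth M = depth N = 0 and finite Gorenstein dimension. Assume that over every depth-1 commutative Noetherian local ring there is no pair of Tor-independent modules of finite Gorenstein dimension both of depth 0. Then M = 0 or N = 0. -/

import Mathlib

open CategoryTheory

universe u

/-- `Tor_i` over `R`, for bundled modules. -/
noncomputable def torM (R : Type u) [CommRing R] (i : ℕ) (M N : ModuleCat.{u} R) :
    ModuleCat.{u} R :=
  ((Tor (ModuleCat.{u} R) i).obj M).obj N

/-- `Tor_i^R(M, N)` for unbundled modules. -/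
noncomputable def torMod (R : Type u) [CommRing R] (i : ℕ)
    (M N : Type u) [AddCommGroup M] [Module R M] [AddCommGroup N] [Module R N] :
    ModuleCat.{u} R :=
  torM R i (ModuleCat.of R M) (ModuleCat.of R N)

/-- `M` and `N` are Tor-independent over `R`: `Tor_i^R(M,N) = 0` for all `i ≥ 1`. -/
def TorIndep (R : Type u) [CommRing R]
    (M N : Type u) [AddCommGroup M] [Module R M] [AddCommGroup N] [Module R N] : Prop :=
  ∀ i : ℕ, 1 ≤ i → Subsingleton (torMod R i M N)

/-- `Ext^i_R(M, N)` for unbundled modules. -/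
noncomputable def extMod (R : Type u) [CommRing R] (i : ℕ)
    (M N : Type u) [AddCommGroup M] [Module R M] [AddCommGroup N] [Module R N] :
    ModuleCat.{u} R :=
  ((Ext R (ModuleCat.{u} R) i).obj (Opposite.op (ModuleCat.of R M))).obj (ModuleCat.of R N)

/-- Depth of a module over a local ring: the least `i` with `Ext^i(k, M) ≠ 0`
(and `⊤` if all such Ext vanish, e.g. for the zero module). -/
noncomputable def eDepth (R : Type u) [CommRing R] [IsLocalRing R]
    (M : Type u) [AddCommGroup M] [Module R M] : ℕ∞ :=
  sInf {n : ℕ∞ | ∃ i : ℕ, n = (i : ℕ∞) ∧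
    Nontrivial (extMod R i (IsLocalRing.ResidueField R) M)}

/-- A totally reflexive module: finitely generated, reflexive, and
`Ext^i(M,R) = Ext^i(M*,R) = 0` for all `i ≥ 1`. -/
def TotReflexive (R : Type u) [CommRing R]
    (M : Type u) [AddCommGroup M] [Module R M] : Prop :=
  Module.Finite R M ∧ Module.IsReflexive R M ∧
    (∀ i : ℕ, 1 ≤ i → Subsingleton (extMod R i M R)) ∧
    (∀ i : ℕ, 1 ≤ i → Subsingleton (extMod R i (Module.Dual R M) R))

/-- `GdimLE R n M` : `M` admits a resolution of length `n` by totally reflexive modules. -/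
inductive GdimLE (R : Type u) [CommRing R] : ℕ → ModuleCat.{u} R → Prop
  | zero (M : ModuleCat.{u} R) (h : TotReflexive R M) : GdimLE R 0 M
  | succ (n : ℕ) (M K G : ModuleCat.{u} R) (hG : TotReflexive R G)
      (f : K ⟶ G) (g : G ⟶ M)
      (hf : Function.Injective f) (hfg : Function.Exact f g) (hg : Function.Surjective g)
      (hK : GdimLE R n K) : GdimLE R (n + 1) M

/-- Gorenstein dimension (Auslander–Bridger) of a module, as an extended natural number. -/
noncomputable def gdim (R : Type u) [CommRing R] (M : ModuleCat.{u} R) : ℕ∞ :=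
  sInf {n : ℕ∞ | ∃ k : ℕ, n = (k : ℕ∞) ∧ GdimLE R k M}

section ExtVanishing

variable {R : Type u} [CommRing R]

/-- Exactness of `Hom(P, Y)` in positive degree, for a projective resolution `P`. -/
lemma subsingleton_extMod_succ_iff (M N : Type u) [AddCommGroup M] [Module R M]
    [AddCommGroup N] [Module R N] (P : ProjectiveResolution (ModuleCat.of R M)) (n : ℕ) :
    Subsingleton (extMod R (n + 1) M N) ↔
      ∀ f : P.complex.X (n + 1) ⟶ ModuleCat.of R N, P.complex.d (n + 2) (n + 1) ≫ f = 0 →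
        ∃ g : P.complex.X n ⟶ ModuleCat.of R N, P.complex.d (n + 1) n ≫ g = f := by
  rw [← ModuleCat.isZero_iff_subsingleton]
  unfold extMod
  rw [(P.isoExt (n + 1) (ModuleCat.of R N)).isZero_iff,
    ← HomologicalComplex.exactAt_iff_isZero_homology,
    HomologicalComplex.exactAt_iff' _ n (n + 1) (n + 2) (by simp) (by simp),
    ShortComplex.moduleCat_exact_iff]
  rfl

lemma subsingleton_extMod_zero_iff (M N : Type u) [AddCommGroup M] [Module R M]
    [AddCommGroup N] [Module R N] (P : ProjectiveResolution (ModuleCat.of R M)) :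
    Subsingleton (extMod R 0 M N) ↔
      ∀ f : P.complex.X 0 ⟶ ModuleCat.of R N, P.complex.d 1 0 ≫ f = 0 → f = 0 := by
  rw [← ModuleCat.isZero_iff_subsingleton]
  unfold extMod
  rw [(P.isoExt 0 (ModuleCat.of R N)).isZero_iff,
    ← HomologicalComplex.exactAt_iff_isZero_homology,
    HomologicalComplex.exactAt_iff' _ 0 0 1 (by simp) (by simp),
    ShortComplex.moduleCat_exact_iff]
  constructor
  · intro h f hf
    obtain ⟨(g : P.complex.X 0 ⟶ ModuleCat.of R N), hg⟩ := h f hf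
    have hd : P.complex.d 0 0 = 0 := P.complex.shape _ _ (by simp)
    have hg' : P.complex.d 0 0 ≫ g = f := hg
    rw [← hg', hd, Limits.zero_comp]
  · intro h f hf
    exact ⟨0, by rw [map_zero]; exact (h f hf).symm⟩

/-- Vanishing of the derived-functor `Ext` agrees with that of `Abelian.Ext`. -/
lemma subsingleton_extMod_succ_iff_ext (M N : Type u) [AddCommGroup M] [Module R M]
    [AddCommGroup N] [Module R N] (n : ℕ) :
    Subsingleton (extMod R (n + 1) M N) ↔
      Subsingleton (Abelian.Ext (ModuleCat.of R M) (ModuleCat.of R N) (n + 1)) := by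
  let P := projectiveResolution (ModuleCat.of R M)
  rw [subsingleton_extMod_succ_iff M N P]
  constructor
  · intro h
    refine subsingleton_of_forall_eq 0 fun α ↦ ?_
    obtain ⟨f, hf, rfl⟩ := P.extMk_surjective α (n + 2) rfl
    exact (P.extMk_eq_zero_iff f _ rfl hf n rfl).2 (h f hf)
  · intro h f hf
    exact (P.extMk_eq_zero_iff f (n + 2) rfl hf n rfl).1 (Subsingleton.elim _ _)

lemma subsingleton_extMod_zero_iff_hom (M N : Type u) [AddCommGroup M] [Module R M]
    [AddCommGroup N] [Module R N] :
    Subsingleton (extMod R 0 M N) ↔ Subsingleton (M →ₗ[R] N) := by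
  let P := projectiveResolution (ModuleCat.of R M)
  let π : P.complex.X 0 ⟶ ModuleCat.of R M := P.π.f 0
  have hπ : P.complex.d 1 0 ≫ π = 0 := P.complex_d_comp_π_f_zero
  have : Epi π := inferInstanceAs (Epi (P.π.f 0))
  rw [subsingleton_extMod_zero_iff M N P]
  constructor
  · intro h
    refine subsingleton_of_forall_eq 0 fun f ↦ ?_
    have hf : π ≫ ModuleCat.ofHom f = 0 := h _ (by
      rw [← Category.assoc, hπ, Limits.zero_comp])
    have h2 : ModuleCat.ofHom f = 0 := by
      rw [← cancel_epi π, hf, Limits.comp_zero]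
    exact congrArg ModuleCat.Hom.hom h2
  · intro h f hf
    let g : ModuleCat.of R M ⟶ ModuleCat.of R N :=
      P.isColimitCokernelCofork.desc (Limits.CokernelCofork.ofπ f hf)
    have hg : π ≫ g = f :=
      P.isColimitCokernelCofork.fac _ Limits.WalkingParallelPair.one
    have : g = 0 := ModuleCat.hom_ext (Subsingleton.elim _ _)
    rw [← hg, this, Limits.comp_zero]

end ExtVanishing

section ExtSequences

variable {R : Type u} [CommRing R]
  {A B C N : Type u} [AddCommGroup A] [Module R A] [AddCommGroup B] [Module R B]
  [AddCommGroup C] [Module R C] [AddCommGroup N] [Module R N]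

/-- The short complex in `ModuleCat R` attached to a short exact sequence of modules. -/
abbrev moduleShortComplex (f : A →ₗ[R] B) (g : B →ₗ[R] C) (h : Function.Exact f g) :
    ShortComplex (ModuleCat.{u} R) :=
  ShortComplex.mk (ModuleCat.ofHom f) (ModuleCat.ofHom g)
    (by ext x; exact h.apply_apply_eq_zero x)

lemma moduleShortComplex_shortExact {f : A →ₗ[R] B} {g : B →ₗ[R] C} (hf : Function.Injective f)
    (h : Function.Exact f g) (hg : Function.Surjective g) :
    (moduleShortComplex f g h).ShortExact where
  exact := by
    rw [ShortComplex.moduleCat_exact_iff]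
    exact fun x hx ↦ (h x).1 hx
  mono_f := (ModuleCat.mono_iff_injective _).2 hf
  epi_g := (ModuleCat.epi_iff_surjective _).2 hg

lemma extMod_extends {f : A →ₗ[R] B} {g : B →ₗ[R] C} (hf : Function.Injective f)
    (h : Function.Exact f g) (hg : Function.Surjective g)
    (hC : Subsingleton (extMod R 1 C N)) (φ : A →ₗ[R] N) :
    ∃ ψ : B →ₗ[R] N, ψ ∘ₗ f = φ := by
  have hS := moduleShortComplex_shortExact hf h hg
  rw [subsingleton_extMod_succ_iff_ext] at hC
  obtain ⟨x, hx⟩ := Abelian.Ext.contravariant_sequence_exact₁ hS (ModuleCat.of R N)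
    (Abelian.Ext.mk₀ (ModuleCat.ofHom φ)) (n₁ := 1) rfl (hC.elim _ _)
  obtain ⟨ψ, rfl⟩ := Abelian.Ext.homEquiv₀.symm.surjective x
  refine ⟨ψ.hom, ?_⟩
  have h2 : Abelian.Ext.mk₀ (ModuleCat.ofHom f ≫ ψ) = Abelian.Ext.mk₀ (ModuleCat.ofHom φ) := by
    rw [← hx, ← Abelian.Ext.mk₀_comp_mk₀]
    rfl
  have h3 := Abelian.Ext.homEquiv₀.symm.injective h2
  exact congrArg ModuleCat.Hom.hom h3

lemma extMod_one_of_extends {f : A →ₗ[R] B} {g : B →ₗ[R] C} (hf : Function.Injective f)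
    (h : Function.Exact f g) (hg : Function.Surjective g)
    (hB : Subsingleton (extMod R 1 B N))
    (H : ∀ φ : A →ₗ[R] N, ∃ ψ : B →ₗ[R] N, ψ ∘ₗ f = φ) :
    Subsingleton (extMod R 1 C N) := by
  have hS := moduleShortComplex_shortExact hf h hg
  rw [subsingleton_extMod_succ_iff_ext] at hB ⊢
  refine subsingleton_of_forall_eq 0 fun x ↦ ?_
  obtain ⟨y, rfl⟩ := Abelian.Ext.contravariant_sequence_exact₃ hS (ModuleCat.of R N) x
    (hB.elim _ _) (n₀ := 0) rfl
  obtain ⟨φ, rfl⟩ := Abelian.Ext.homEquiv₀.symm.surjective y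
  obtain ⟨ψ, hψ⟩ := H φ.hom
  have hφ : φ = (moduleShortComplex f g h).f ≫ ModuleCat.ofHom ψ :=
    ModuleCat.hom_ext hψ.symm
  subst hφ
  rw [Abelian.Ext.homEquiv₀_symm_apply, ← Abelian.Ext.mk₀_comp_mk₀,
    hS.extClass_comp_assoc]

lemma extMod_succ_right {f : A →ₗ[R] B} {g : B →ₗ[R] C} (hf : Function.Injective f)
    (h : Function.Exact f g) (hg : Function.Surjective g) (i : ℕ)
    (hA : Subsingleton (extMod R (i + 1) A N)) (hB : Subsingleton (extMod R (i + 2) B N)) :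
    Subsingleton (extMod R (i + 2) C N) := by
  have hS := moduleShortComplex_shortExact hf h hg
  rw [subsingleton_extMod_succ_iff_ext] at hA hB ⊢
  refine subsingleton_of_forall_eq 0 fun x ↦ ?_
  obtain ⟨y, rfl⟩ := Abelian.Ext.contravariant_sequence_exact₃ hS (ModuleCat.of R N) x
    (hB.elim _ _) (n₀ := i + 1) (by omega)
  rw [hA.elim y 0, Abelian.Ext.comp_zero]

lemma extMod_left {f : A →ₗ[R] B} {g : B →ₗ[R] C} (hf : Function.Injective f)
    (h : Function.Exact f g) (hg : Function.Surjective g) (i : ℕ)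
    (hB : Subsingleton (extMod R (i + 1) B N)) (hC : Subsingleton (extMod R (i + 2) C N)) :
    Subsingleton (extMod R (i + 1) A N) := by
  have hS := moduleShortComplex_shortExact hf h hg
  rw [subsingleton_extMod_succ_iff_ext] at hB hC ⊢
  refine subsingleton_of_forall_eq 0 fun x ↦ ?_
  obtain ⟨y, rfl⟩ := Abelian.Ext.contravariant_sequence_exact₁ hS (ModuleCat.of R N) x
    (n₁ := i + 2) (by omega) (hC.elim _ _)
  rw [hB.elim y 0, Abelian.Ext.comp_zero]

lemma extMod_lifts {f : A →ₗ[R] B} {g : B →ₗ[R] C} (hf : Function.Injective f)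
    (h : Function.Exact f g) (hg : Function.Surjective g)
    (hN : Subsingleton (extMod R 1 N A)) (φ : N →ₗ[R] C) :
    ∃ ψ : N →ₗ[R] B, g ∘ₗ ψ = φ := by
  have hS := moduleShortComplex_shortExact hf h hg
  rw [subsingleton_extMod_succ_iff_ext] at hN
  obtain ⟨x, hx⟩ := Abelian.Ext.covariant_sequence_exact₃ (ModuleCat.of R N) hS
    (Abelian.Ext.mk₀ (ModuleCat.ofHom φ)) (n₁ := 1) rfl (hN.elim _ _)
  obtain ⟨ψ, rfl⟩ := Abelian.Ext.homEquiv₀.symm.surjective x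
  refine ⟨ψ.hom, ?_⟩
  have h2 : Abelian.Ext.mk₀ (ψ ≫ ModuleCat.ofHom g) = Abelian.Ext.mk₀ (ModuleCat.ofHom φ) := by
    rw [← hx, ← Abelian.Ext.mk₀_comp_mk₀]
    rfl
  have h3 := Abelian.Ext.homEquiv₀.symm.injective h2
  exact congrArg ModuleCat.Hom.hom h3

lemma extMod_of_projective [Module.Projective R A] (i : ℕ) :
    Subsingleton (extMod R (i + 1) A N) := by
  have : Projective (ModuleCat.of R A) := (IsProjective.iff_projective A).1 inferInstance
  exact ModuleCat.subsingleton_of_isZero (isZero_Ext_succ_of_projective _ _ _)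

lemma extMod_congr (e : A ≃ₗ[R] B) (i : ℕ) (hA : Subsingleton (extMod R i A N)) :
    Subsingleton (extMod R i B N) := by
  rw [← ModuleCat.isZero_iff_subsingleton] at hA ⊢
  exact hA.of_iso (((Ext R (ModuleCat.{u} R) i).mapIso e.toModuleIso.op).app (ModuleCat.of R N))

lemma extMod_middle {f : A →ₗ[R] B} {g : B →ₗ[R] C} (hf : Function.Injective f)
    (h : Function.Exact f g) (hg : Function.Surjective g) (i : ℕ)
    (hA : Subsingleton (extMod R (i + 1) A N)) (hC : Subsingleton (extMod R (i + 1) C N)) :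
    Subsingleton (extMod R (i + 1) B N) := by
  have hS := moduleShortComplex_shortExact hf h hg
  rw [subsingleton_extMod_succ_iff_ext] at hA hC ⊢
  refine subsingleton_of_forall_eq 0 fun x ↦ ?_
  obtain ⟨y, rfl⟩ := Abelian.Ext.contravariant_sequence_exact₂ hS (ModuleCat.of R N) x
    (hA.elim _ _)
  rw [hC.elim y 0, Abelian.Ext.comp_zero]

end ExtSequences

section Splice

open Limits

variable {C : Type*} [Category* C] [Abelian C]

lemma CategoryTheory.ShortComplex.Exact.epi_comp {S : ShortComplex C} (hS : S.Exact) {A : C}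
    (π : A ⟶ S.X₁) [Epi π] (w : (π ≫ S.f) ≫ S.g = 0) : (ShortComplex.mk (π ≫ S.f) S.g w).Exact := by
  let φ : ShortComplex.mk (π ≫ S.f) S.g w ⟶ S :=
    { τ₁ := π, τ₂ := 𝟙 _, τ₃ := 𝟙 _ }
  have : Epi φ.τ₁ := inferInstanceAs (Epi π)
  have : IsIso φ.τ₂ := inferInstanceAs (IsIso (𝟙 _))
  have : Mono φ.τ₃ := inferInstanceAs (Mono (𝟙 _))
  exact (ShortComplex.exact_iff_of_epi_of_isIso_of_mono φ).2 hS

lemma CategoryTheory.ShortComplex.Exact.comp_mono {S : ShortComplex C} (hS : S.Exact) {A : C}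
    (ι : S.X₃ ⟶ A) [Mono ι] (w : S.f ≫ S.g ≫ ι = 0) : (ShortComplex.mk S.f (S.g ≫ ι) w).Exact := by
  let φ : S ⟶ ShortComplex.mk S.f (S.g ≫ ι) w :=
    { τ₁ := 𝟙 _, τ₂ := 𝟙 _, τ₃ := ι }
  have : Epi φ.τ₁ := inferInstanceAs (Epi (𝟙 _))
  have : IsIso φ.τ₂ := inferInstanceAs (IsIso (𝟙 _))
  have : Mono φ.τ₃ := inferInstanceAs (Mono ι)
  exact (ShortComplex.exact_iff_of_epi_of_isIso_of_mono φ).1 hS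

/-- Splicing a projective resolution of `S.X₁` with a short exact sequence whose middle term is
projective gives a projective resolution of `S.X₃`. -/
noncomputable def CategoryTheory.ProjectiveResolution.splice {S : ShortComplex C}
    (hS : S.ShortExact) [Projective S.X₂] (P : ProjectiveResolution S.X₁) :
    ProjectiveResolution S.X₃ :=
  let π : P.complex.X 0 ⟶ S.X₁ := P.π.f 0
  have hπ : P.complex.d 1 0 ≫ π = 0 := P.complex_d_comp_π_f_zero
  have hw : P.complex.d 1 0 ≫ π ≫ S.f = 0 := by rw [← Category.assoc, hπ, zero_comp]
  have hz : (π ≫ S.f) ≫ S.g = 0 := by rw [Category.assoc, S.zero, comp_zero]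
  { complex := P.complex.augment (π ≫ S.f) hw
    projective := by
      rintro (_ | n)
      · exact inferInstanceAs (Projective S.X₂)
      · exact P.projective n
    hasHomology := inferInstance
    π := (ChainComplex.toSingle₀Equiv _ _).symm ⟨S.g, hz⟩
    quasiIso := ⟨fun n ↦ by
      have hepi : Epi π := inferInstanceAs (Epi (P.π.f 0))
      have := hS.mono_f
      cases n with
      | zero =>
        rw [ChainComplex.quasiIsoAt₀_iff, ShortComplex.quasiIso_iff_of_zeros']
        · have hg : ((ChainComplex.toSingle₀Equiv (P.complex.augment (π ≫ S.f) hw) S.X₃).symm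
              ⟨S.g, hz⟩).f 0 = S.g := ChainComplex.toSingle₀Equiv_symm_apply_f_zero _ _
          refine (ShortComplex.exact_and_epi_g_iff_of_iso ?_).2
            ⟨hS.exact.epi_comp π hz, hS.epi_g⟩
          exact ShortComplex.isoMk (Iso.refl _) (Iso.refl _) (Iso.refl _)
            ((Category.id_comp _).trans (Category.comp_id _).symm)
            ((Category.id_comp S.g).trans (hg.symm.trans (Category.comp_id _).symm))
        all_goals rfl
      | succ n =>
        rw [quasiIsoAt_iff_exactAt']
        · cases n with
          | zero =>
            rw [HomologicalComplex.exactAt_iff' _ 2 1 0 (by simp) (by simp)]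
            have h₀ : (ShortComplex.mk (P.complex.d 1 0) π hπ).Exact := P.exact₀
            exact ShortComplex.Exact.comp_mono (S := ShortComplex.mk (P.complex.d 1 0) π hπ)
              h₀ S.f hw
          | succ n =>
            rw [HomologicalComplex.exactAt_iff' _ (n + 3) (n + 2) (n + 1) (by simp) (by simp)]
            exact P.exact_succ n
        · apply ChainComplex.exactAt_succ_single_obj⟩ }

end Splice

section TorSequences

open TensorProduct

variable {R : Type u} [CommRing R] {A B C : Type u} (N : Type u) [AddCommGroup A] [Module R A]
  [AddCommGroup B] [Module R B] [AddCommGroup C] [Module R C] [AddCommGroup N] [Module R N]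

lemma subsingleton_torMod_succ_iff (M : Type u) [AddCommGroup M] [Module R M]
    (P : ProjectiveResolution (ModuleCat.of R M)) (n : ℕ) :
    Subsingleton (torMod R (n + 1) N M) ↔
      Function.Exact ((P.complex.d (n + 2) (n + 1)).hom.lTensor N)
        ((P.complex.d (n + 1) n).hom.lTensor N) := by
  rw [← ModuleCat.isZero_iff_subsingleton]
  unfold torMod torM
  rw [Tor_obj, (P.isoLeftDerivedObj _ (n + 1)).isZero_iff]
  change Limits.IsZero (HomologicalComplex.homology _ _) ↔ _
  rw [← HomologicalComplex.exactAt_iff_isZero_homology,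
    HomologicalComplex.exactAt_iff' _ (n + 2) (n + 1) n (by simp) (by simp),
    ShortComplex.ShortExact.moduleCat_exact_iff_function_exact]
  rfl

variable {f : A →ₗ[R] B} {g : B →ₗ[R] C}

lemma subsingleton_torMod_one_iff [Module.Projective R B] (hf : Function.Injective f)
    (h : Function.Exact f g) (hg : Function.Surjective g) :
    Subsingleton (torMod R 1 N C) ↔ Function.Injective (f.lTensor N) := by
  have hS := moduleShortComplex_shortExact hf h hg
  have : Projective (moduleShortComplex f g h).X₂ :=
    (IsProjective.iff_projective B).1 inferInstance
  let P := projectiveResolution (ModuleCat.of R A)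
  let π : P.complex.X 0 ⟶ ModuleCat.of R A := P.π.f 0
  have hπ : P.complex.d 1 0 ≫ π = 0 := P.complex_d_comp_π_f_zero
  have hex : Function.Exact (P.complex.d 1 0).hom π.hom :=
    (ShortComplex.ShortExact.moduleCat_exact_iff_function_exact _).1 P.exact₀
  have hsurj : Function.Surjective π.hom :=
    (ModuleCat.epi_iff_surjective π).1 (inferInstanceAs (Epi (P.π.f 0)))
  have hex' := lTensor_exact N hex hsurj
  have hsurj' := LinearMap.lTensor_surjective N hsurj
  rw [subsingleton_torMod_succ_iff N C (ProjectiveResolution.splice hS P) 0]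
  change Function.Exact ((P.complex.d 1 0).hom.lTensor N) ((f ∘ₗ π.hom).lTensor N) ↔ _
  rw [LinearMap.lTensor_comp]
  constructor
  · intro H
    rw [injective_iff_map_eq_zero]
    intro z hz
    obtain ⟨y, rfl⟩ := hsurj' z
    exact (hex' y).2 ((H y).1 hz)
  · intro H y
    rw [← hex' y]
    exact map_eq_zero_iff _ H

lemma subsingleton_torMod_succ_succ_iff [Module.Projective R B] (hf : Function.Injective f)
    (h : Function.Exact f g) (hg : Function.Surjective g) (i : ℕ) :
    Subsingleton (torMod R (i + 2) N C) ↔ Subsingleton (torMod R (i + 1) N A) := by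
  have hS := moduleShortComplex_shortExact hf h hg
  have : Projective (moduleShortComplex f g h).X₂ :=
    (IsProjective.iff_projective B).1 inferInstance
  let P := projectiveResolution (ModuleCat.of R A)
  rw [subsingleton_torMod_succ_iff N C (ProjectiveResolution.splice hS P) (i + 1),
    subsingleton_torMod_succ_iff N A P i]
  rfl

end TorSequences

section TorIndependence

open TensorProduct

variable {R : Type u} [CommRing R] {K F M L E N : Type u}
  [AddCommGroup K] [Module R K] [AddCommGroup F] [Module R F] [AddCommGroup M] [Module R M]
  [AddCommGroup L] [Module R L] [AddCommGroup E] [Module R E] [AddCommGroup N] [Module R N]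
  {f : K →ₗ[R] F} {g : F →ₗ[R] M} {f' : L →ₗ[R] E} {g' : E →ₗ[R] N}

lemma rTensor_injective_of_lTensor_injective [Module.Flat R E] (hf : Function.Injective f)
    (h : Function.Exact f g) (hg : Function.Surjective g)
    (h' : Function.Exact f' g') (hg' : Function.Surjective g')
    (H : Function.Injective (f'.lTensor M)) : Function.Injective (f.rTensor N) := by
  have comm {A B C D : Type u} [AddCommGroup A] [Module R A] [AddCommGroup B] [Module R B]
      [AddCommGroup C] [Module R C] [AddCommGroup D] [Module R D] (p : A →ₗ[R] B)
      (q : C →ₗ[R] D) (z : A ⊗[R] C) :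
      p.rTensor D (q.lTensor A z) = q.lTensor B (p.rTensor C z) := by
    rw [← LinearMap.comp_apply, ← LinearMap.comp_apply, LinearMap.rTensor_comp_lTensor,
      LinearMap.lTensor_comp_rTensor]
  rw [injective_iff_map_eq_zero]
  intro z hz
  obtain ⟨w, rfl⟩ := LinearMap.lTensor_surjective K hg' z
  rw [comm] at hz
  obtain ⟨v, hv⟩ := (lTensor_exact F h' hg' _).1 hz
  have hv0 : g.rTensor L v = 0 := by
    apply H
    rw [← comm, hv, map_zero]
    exact (rTensor_exact E h hg _).2 ⟨w, rfl⟩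
  obtain ⟨t, rfl⟩ := (rTensor_exact L h hg _).1 hv0
  rw [← comm] at hv
  obtain rfl := Module.Flat.rTensor_preserves_injective_linearMap f hf hv
  exact (lTensor_exact K h' hg' _).2 ⟨t, rfl⟩

lemma TorIndep.syzygy_right [Module.Projective R E] (hT : TorIndep R M N)
    (hf' : Function.Injective f') (h' : Function.Exact f' g') (hg' : Function.Surjective g') :
    TorIndep R M L := by
  rintro (_ | i) hi
  · omega
  · exact (subsingleton_torMod_succ_succ_iff M hf' h' hg' i).1 (hT _ (by omega))

lemma exists_free_presentation (R : Type u) [CommRing R] (N : Type u) [AddCommGroup N]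
    [Module R N] :
    ∃ (L E : Type u) (_ : AddCommGroup L) (_ : Module R L) (_ : AddCommGroup E) (_ : Module R E)
      (f : L →ₗ[R] E) (g : E →ₗ[R] N), Module.Free R E ∧ Function.Injective f ∧
        Function.Exact f g ∧ Function.Surjective g :=
  let q := Finsupp.linearCombination R (id : N → N)
  ⟨LinearMap.ker q, N →₀ R, inferInstance, inferInstance, inferInstance, inferInstance,
    (LinearMap.ker q).subtype, q, inferInstance, Submodule.subtype_injective _,
    q.exact_subtype_ker_map, Finsupp.linearCombination_id_surjective R N⟩

lemma TorIndep.syzygy_left_one [Module.Flat R F] (hT : TorIndep R M N)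
    (hf : Function.Injective f) (h : Function.Exact f g) (hg : Function.Surjective g) :
    Subsingleton (torMod R 1 K N) := by
  obtain ⟨L, E, _, _, _, _, i, q, _, hi, he, hq⟩ := exists_free_presentation R N
  obtain ⟨L', E', _, _, _, _, i', q', _, hi', he', hq'⟩ := exists_free_presentation R L
  have hinj := rTensor_injective_of_lTensor_injective hf h hg he' hq'
    ((subsingleton_torMod_one_iff M hi' he' hq').1 (hT.syzygy_right hi he hq 1 le_rfl))
  rw [subsingleton_torMod_one_iff K hi he hq]
  have hc : Function.Injective (f.rTensor E ∘ₗ i.lTensor K) := by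
    rw [LinearMap.rTensor_comp_lTensor, ← LinearMap.lTensor_comp_rTensor, LinearMap.coe_comp]
    exact (Module.Flat.lTensor_preserves_injective_linearMap _ hi).comp hinj
  rw [LinearMap.coe_comp] at hc
  exact hc.of_comp

lemma TorIndep.syzygy_left [Module.Flat R F] (hT : TorIndep R M N)
    (hf : Function.Injective f) (h : Function.Exact f g) (hg : Function.Surjective g) :
    TorIndep R K N := by
  have key (i : ℕ) : ∀ (N : Type u) [AddCommGroup N] [Module R N], TorIndep R M N →
      Subsingleton (torMod R (i + 1) K N) := by
    induction i with
    | zero => exact fun N _ _ hT ↦ hT.syzygy_left_one hf h hg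
    | succ i ih =>
      intro N _ _ hT
      obtain ⟨L, E, _, _, _, _, j, q, _, hi, he, hq⟩ := exists_free_presentation R N
      rw [subsingleton_torMod_succ_succ_iff K hi he hq]
      exact ih _ (hT.syzygy_right hi he hq)
  rintro (_ | i) hi
  · omega
  · exact key i N hT

lemma TorIndep.isSMulRegular_tensor_syzygy [Module.Projective R F] [Module.Projective R E]
    (hT : TorIndep R M N) (hf : Function.Injective f) (h : Function.Exact f g)
    (hg : Function.Surjective g) (hf' : Function.Injective f') (h' : Function.Exact f' g')
    (hg' : Function.Surjective g') {x : R} (hx : IsSMulRegular R x) :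
    IsSMulRegular (K ⊗[R] L) x := by
  have h1 : Function.Injective (f'.lTensor K) :=
    (subsingleton_torMod_one_iff K hf' h' hg').1 (hT.syzygy_left hf h hg 1 le_rfl)
  have h2 : Function.Injective (f.rTensor E) :=
    Module.Flat.rTensor_preserves_injective_linearMap f hf
  have hreg : IsSMulRegular (F ⊗[R] E) x := by
    have := (IsSMulRegular.lTensor (F ⊗[R] E) hx : IsSMulRegular (F ⊗[R] E ⊗[R] R) x)
    exact ((TensorProduct.rid R _).isSMulRegular_congr x).1 this
  intro a b hab
  apply h1
  apply h2
  apply hreg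
  simpa using congrArg (fun z ↦ f.rTensor E (f'.lTensor K z)) hab

end TorIndependence

section Reduction

open TensorProduct

/-- A linear map exhibiting its target as the quotient of its source by the multiples of `x`. -/
structure IsReductionMod {R G G' : Type*} [CommRing R] [AddCommGroup G] [Module R G]
    [AddCommGroup G'] [Module R G'] (x : R) (π : G →ₗ[R] G') : Prop where
  surjective : Function.Surjective π
  eq_zero_iff (g : G) : π g = 0 ↔ ∃ h, x • h = g

lemma IsReductionMod.linearMap_ext {R S G C X : Type*} [CommRing R] [CommRing S] [AddCommGroup G]
    [Module R G] [AddCommGroup C] [Module R C] [Module S C] [AddCommGroup X] [Module S X] {x : R}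
    {π : G →ₗ[R] C} (h : IsReductionMod x π) {φ ψ : C →ₗ[S] X}
    (hφ : ∀ g, φ (π g) = ψ (π g)) : φ = ψ := by
  ext y
  obtain ⟨g, rfl⟩ := h.surjective y
  exact hφ g

variable {R S : Type u} [CommRing R] [CommRing S] [Algebra R S] {x : R}
  {K F G X K' F' G' : Type u} [AddCommGroup K] [Module R K] [AddCommGroup F] [Module R F]
  [AddCommGroup G] [Module R G] [AddCommGroup X] [Module R X] [Module S X] [IsScalarTower R S X]
  [AddCommGroup K'] [Module R K'] [Module S K'] [IsScalarTower R S K']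
  [AddCommGroup F'] [Module R F'] [Module S F'] [IsScalarTower R S F']
  [AddCommGroup G'] [Module R G'] [Module S G'] [IsScalarTower R S G']
  {πK : K →ₗ[R] K'} {πF : F →ₗ[R] F'} {πG : G →ₗ[R] G'}

namespace IsReductionMod

lemma map_smul_eq_zero (h : IsReductionMod x πG) (g : G) : πG (x • g) = 0 :=
  (h.eq_zero_iff _).2 ⟨g, rfl⟩

lemma exact (h : IsReductionMod x πG) : Function.Exact (LinearMap.lsmul R G x) πG :=
  fun g ↦ h.eq_zero_iff g

lemma algebraMap_surjective (hS : IsReductionMod x (Algebra.linearMap R S)) :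
    Function.Surjective (algebraMap R S) :=
  hS.surjective

lemma algebraMap_self (hS : IsReductionMod x (Algebra.linearMap R S)) : algebraMap R S x = 0 :=
  (hS.eq_zero_iff x).2 ⟨1, by simp⟩

lemma smul_eq_zero (hS : IsReductionMod x (Algebra.linearMap R S)) (y : X) : x • y = 0 := by
  rw [← algebraMap_smul S, hS.algebraMap_self, zero_smul]

lemma exists_lift (hS : IsReductionMod x (Algebra.linearMap R S)) (h : IsReductionMod x πG)
    (φ : G →ₗ[R] X) : ∃ ψ : G' →ₗ[S] X, ∀ g, ψ (πG g) = φ g := by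
  have hk : LinearMap.ker πG ≤ LinearMap.ker φ := by
    intro g hg
    obtain ⟨y, rfl⟩ := (h.eq_zero_iff g).1 hg
    rw [LinearMap.mem_ker, map_smul, hS.smul_eq_zero]
  let e := πG.quotKerEquivOfSurjective h.surjective
  refine ⟨LinearMap.extendScalarsOfSurjective hS.algebraMap_surjective
    ((LinearMap.ker πG).liftQ φ hk ∘ₗ e.symm.toLinearMap), fun g ↦ ?_⟩
  have : e.symm (πG g) = (LinearMap.ker πG).mkQ g :=
    e.symm_apply_eq.2 rfl
  simp [this]

lemma exists_ker {C : Type u} [AddCommGroup C] [Module R C] [Module S C] {πC : G →ₗ[R] C}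
    {f : K →ₗ[R] F} {g : F →ₗ[R] G} {f' : K' →ₗ[S] F'} {g' : F' →ₗ[S] C}
    (hF : IsReductionMod x πF) (hG : IsReductionMod x πC) (hx : IsSMulRegular G x)
    (hf : Function.Injective f) (h : Function.Exact f g) (hg : Function.Surjective g)
    (hf' : Function.Injective f') (h' : Function.Exact f' g')
    (hc : ∀ y, g' (πF y) = πC (g y)) :
    ∃ πK : K →ₗ[R] K', IsReductionMod x πK ∧ ∀ k, f' (πK k) = πF (f k) := by
  let i : K' →ₗ[R] F' := f'.restrictScalars R
  have hi : Function.Injective i := hf'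
  have hmem (k : K) : πF (f k) ∈ LinearMap.range i := by
    refine (h' _).1 ?_
    rw [hc, h.apply_apply_eq_zero, map_zero]
  let e := LinearEquiv.ofInjective i hi
  let π : K →ₗ[R] K' := e.symm.toLinearMap ∘ₗ (πF ∘ₗ f).codRestrict _ hmem
  have hπ (k : K) : f' (π k) = πF (f k) :=
    congrArg Subtype.val (e.apply_symm_apply ((πF ∘ₗ f).codRestrict _ hmem k))
  refine ⟨π, ⟨fun k' ↦ ?_, fun k ↦ ⟨fun hk ↦ ?_, ?_⟩⟩, hπ⟩
  · obtain ⟨y, hy⟩ := hF.surjective (f' k')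
    have : πC (g y) = 0 := by rw [← hc, hy, h'.apply_apply_eq_zero]
    obtain ⟨z, hz⟩ := (hG.eq_zero_iff _).1 this
    obtain ⟨w, rfl⟩ := hg z
    obtain ⟨k, hk⟩ := (h (y - x • w)).1 (by rw [map_sub, map_smul, hz, sub_self])
    refine ⟨k, hf' ?_⟩
    rw [hπ, hk, map_sub, hF.map_smul_eq_zero, sub_zero, hy]
  · obtain ⟨y, hy⟩ := (hF.eq_zero_iff (f k)).1 (by rw [← hπ, hk, map_zero])
    have : g y = 0 := by
      apply hx
      simp only
      rw [← map_smul, hy, h.apply_apply_eq_zero, smul_zero]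
    obtain ⟨w, rfl⟩ := (h y).1 this
    exact ⟨w, hf (by rw [map_smul, hy])⟩
  · rintro ⟨w, rfl⟩
    apply hf'
    rw [hπ, map_smul, hF.map_smul_eq_zero, map_zero]

lemma exists_tensor (hS : IsReductionMod x (Algebra.linearMap R S)) (hF : IsReductionMod x πF)
    (hG : IsReductionMod x πG) :
    ∃ ρ : F ⊗[R] G →ₗ[R] F' ⊗[S] G', IsReductionMod x ρ ∧
      ∀ y z, ρ (y ⊗ₜ z) = πF y ⊗ₜ πG z := by
  have : TensorProduct.CompatibleSMul R S F' G' :=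
    TensorProduct.CompatibleSMul.of_algebraMap_surjective F' G' hS.algebraMap_surjective
  let e := TensorProduct.equivOfCompatibleSMul S R R F' G'
  refine ⟨e.toLinearMap ∘ₗ TensorProduct.map πF πG, ⟨?_, fun t ↦ ?_⟩, fun y z ↦ ?_⟩
  · exact e.surjective.comp (TensorProduct.map_surjective hF.surjective hG.surjective)
  · have hker := TensorProduct.map_ker hF.exact hF.surjective hG.exact hG.surjective
    have h1 : LinearMap.range (LinearMap.lTensor F (LinearMap.lsmul R G x)) =
        LinearMap.range (LinearMap.lsmul R (F ⊗[R] G) x) := by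
      congr 1; ext; simp
    have h2 : LinearMap.range (LinearMap.rTensor G (LinearMap.lsmul R F x)) =
        LinearMap.range (LinearMap.lsmul R (F ⊗[R] G) x) := by
      congr 1
    rw [h1, h2, sup_idem] at hker
    have := SetLike.ext_iff.1 hker t
    simpa using this
  · rfl

lemma finsupp (hS : IsReductionMod x (Algebra.linearMap R S)) (ι : Type u) :
    IsReductionMod x (Finsupp.mapRange.linearMap (α := ι) (Algebra.linearMap R S)) := by
  refine ⟨Finsupp.mapRange_surjective _ (map_zero _) hS.surjective, fun g ↦ ⟨fun hg ↦ ?_, ?_⟩⟩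
  · have H (i : ι) : ∃ r, x • r = g i :=
      (hS.eq_zero_iff _).1 (by simpa using DFunLike.congr_fun hg i)
    classical
    choose r hr using H
    refine ⟨Finsupp.onFinset g.support (fun i ↦ if g i = 0 then 0 else r i) ?_, ?_⟩
    · intro i; simp; tauto
    · ext i
      by_cases hi : g i = 0 <;> simp [hi] ; simpa using hr i
  · rintro ⟨y, rfl⟩
    ext i
    simpa using hS.smul_eq_zero (algebraMap R S (y i))

lemma exists_free_cover (hS : IsReductionMod x (Algebra.linearMap R S))
    (hG : IsReductionMod x πG) (hxR : IsSMulRegular R x) (hx : IsSMulRegular G x) :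
    ∃ (K F K' F' : Type u) (_ : AddCommGroup K) (_ : Module R K) (_ : AddCommGroup F)
      (_ : Module R F) (_ : AddCommGroup K') (_ : Module R K') (_ : Module S K')
      (_ : IsScalarTower R S K') (_ : AddCommGroup F') (_ : Module R F') (_ : Module S F')
      (_ : IsScalarTower R S F') (f : K →ₗ[R] F) (g : F →ₗ[R] G) (f' : K' →ₗ[S] F')
      (g' : F' →ₗ[S] G') (πK : K →ₗ[R] K') (πF : F →ₗ[R] F'),
      Module.Free R F ∧ Module.Free S F' ∧ IsReductionMod x πK ∧ IsReductionMod x πF ∧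
      IsSMulRegular K x ∧ IsSMulRegular F x ∧ Function.Injective f ∧ Function.Exact f g ∧
      Function.Surjective g ∧ Function.Injective f' ∧ Function.Exact f' g' ∧
      Function.Surjective g' ∧ (∀ k, f' (πK k) = πF (f k)) ∧ (∀ y, g' (πF y) = πG (g y)) := by
  let g := Finsupp.linearCombination R (id : G → G)
  let g' := Finsupp.linearCombination S (πG : G → G')
  have hg : Function.Surjective g := Finsupp.linearCombination_id_surjective R G
  have hF := hS.finsupp G
  have hc (y : G →₀ R) : g' (Finsupp.mapRange.linearMap (Algebra.linearMap R S) y) = πG (g y) := by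
    induction y using Finsupp.induction_linear with
    | zero => simp
    | add a b ha hb => simp only [map_add, ha, hb]
    | single i r => simp [g, g']
  have hg' : Function.Surjective g' := by
    intro z
    obtain ⟨w, rfl⟩ := hG.surjective z
    obtain ⟨y, rfl⟩ := hg w
    exact ⟨_, hc y⟩
  obtain ⟨πK, hK, hKF⟩ := exists_ker (K := LinearMap.ker g) (K' := LinearMap.ker g') hF hG hx
    (Submodule.subtype_injective (LinearMap.ker g))
    g.exact_subtype_ker_map hg (Submodule.subtype_injective (LinearMap.ker g'))
    g'.exact_subtype_ker_map hc
  have hxF : IsSMulRegular (G →₀ R) x := by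
    intro a b hab
    ext i
    exact hxR (by simpa using DFunLike.congr_fun hab i)
  exact ⟨LinearMap.ker g, G →₀ R, LinearMap.ker g', G →₀ S, inferInstance, inferInstance,
    inferInstance, inferInstance, inferInstance, inferInstance, inferInstance, inferInstance,
    inferInstance, inferInstance, inferInstance, inferInstance, (LinearMap.ker g).subtype, g,
    (LinearMap.ker g').subtype, g', πK, _, inferInstance, inferInstance, hK, hF,
    hxF.submodule _ _, hxF, Submodule.subtype_injective _, g.exact_subtype_ker_map, hg,
    Submodule.subtype_injective _, g'.exact_subtype_ker_map, hg', hKF, hc⟩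

end IsReductionMod

end Reduction

section TorReduction

open TensorProduct

variable {R S : Type u} [CommRing R] [CommRing S] [Algebra R S] {x : R}
  {K K' : Type u} [AddCommGroup K] [Module R K]
  [AddCommGroup K'] [Module R K'] [Module S K'] [IsScalarTower R S K'] {πK : K →ₗ[R] K'}

lemma subsingleton_torMod_reduction (hS : IsReductionMod x (Algebra.linearMap R S))
    (hxR : IsSMulRegular R x) (hxK : IsSMulRegular K x) (hK : IsReductionMod x πK) (i : ℕ) :
    ∀ {L L' : Type u} [AddCommGroup L] [Module R L] [AddCommGroup L'] [Module R L'] [Module S L']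
      [IsScalarTower R S L'] {πL : L →ₗ[R] L'}, IsReductionMod x πL → IsSMulRegular L x →
      IsSMulRegular (K ⊗[R] L) x → TorIndep R K L → Subsingleton (torMod S (i + 1) K' L') := by
  induction i with
  | zero =>
    intro L L' _ _ _ _ _ _ πL hL hxL hx hT
    obtain ⟨P, F, P', F', _, _, _, _, _, _, _, _, _, _, _, _, f, g, f', g', πP, πF, _, _, hP, hF,
      hxP, hxF, hf, h, hg, hf', h', hg', hc, -⟩ := hS.exists_free_cover hL hxR hxL
    rw [subsingleton_torMod_one_iff K' hf' h' hg', injective_iff_map_eq_zero]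
    obtain ⟨ρP, hρP, hρP'⟩ := hS.exists_tensor hK hP
    obtain ⟨ρF, hρF, hρF'⟩ := hS.exists_tensor hK hF
    have comm (z : K ⊗[R] P) : f'.lTensor K' (ρP z) = ρF (f.lTensor K z) := by
      induction z with
      | zero => simp
      | add a b ha hb => simp only [map_add, ha, hb]
      | tmul k p => rw [hρP', LinearMap.lTensor_tmul, LinearMap.lTensor_tmul, hρF', hc]
    intro z' hz'
    obtain ⟨z, rfl⟩ := hρP.surjective z'
    rw [comm] at hz'
    obtain ⟨w, hw⟩ := (hρF.eq_zero_iff _).1 hz'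
    have hw0 : g.lTensor K w = 0 := by
      apply hx
      simp only
      rw [← map_smul, hw, smul_zero]
      exact (lTensor_exact K h hg).apply_apply_eq_zero z
    obtain ⟨y, rfl⟩ := (lTensor_exact K h hg w).1 hw0
    have hinj := (subsingleton_torMod_one_iff K hf h hg).1 (hT 1 le_rfl)
    obtain rfl : x • y = z := hinj (by rw [map_smul, hw])
    exact hρP.map_smul_eq_zero y
  | succ i ih =>
    intro L L' _ _ _ _ _ _ πL hL hxL hx hT
    obtain ⟨P, F, P', F', _, _, _, _, _, _, _, _, _, _, _, _, f, g, f', g', πP, πF, _, _, hP, hF,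
      hxP, hxF, hf, h, hg, hf', h', hg', hc, -⟩ := hS.exists_free_cover hL hxR hxL
    rw [subsingleton_torMod_succ_succ_iff K' hf' h' hg']
    refine ih hP hxP ?_ (hT.syzygy_right hf h hg)
    have hinj := (subsingleton_torMod_one_iff K hf h hg).1 (hT 1 le_rfl)
    have hxKF : IsSMulRegular (K ⊗[R] F) x := hxK.rTensor F
    intro a b hab
    apply hinj
    apply hxKF
    simpa using congrArg (f.lTensor K) hab

lemma TorIndep.reduction (hS : IsReductionMod x (Algebra.linearMap R S))
    (hxR : IsSMulRegular R x) {L L' : Type u} [AddCommGroup L] [Module R L] [AddCommGroup L']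
    [Module R L'] [Module S L'] [IsScalarTower R S L'] {πL : L →ₗ[R] L'}
    (hxK : IsSMulRegular K x) (hK : IsReductionMod x πK)
    (hL : IsReductionMod x πL) (hxL : IsSMulRegular L x) (hx : IsSMulRegular (K ⊗[R] L) x)
    (hT : TorIndep R K L) : TorIndep S K' L' := by
  rintro (_ | i) hi
  · omega
  · exact subsingleton_torMod_reduction hS hxR hxK hK i hL hxL hx hT

end TorReduction

section TotReflexiveReduction

lemma Function.Exact.exists_linearMap_comp_eq {R A B C X : Type*} [CommRing R] [AddCommGroup A]
    [Module R A] [AddCommGroup B] [Module R B] [AddCommGroup C] [Module R C] [AddCommGroup X]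
    [Module R X] {f : A →ₗ[R] B} {g : B →ₗ[R] C} (h : Function.Exact f g)
    (hf : Function.Injective f) (φ : X →ₗ[R] B) (hφ : ∀ y, g (φ y) = 0) :
    ∃ ψ : X →ₗ[R] A, ∀ y, f (ψ y) = φ y := by
  let e := LinearEquiv.ofInjective f hf
  let φ' := φ.codRestrict (LinearMap.range f) fun y ↦ (h _).1 (hφ y)
  exact ⟨e.symm.toLinearMap ∘ₗ φ', fun y ↦ congrArg Subtype.val (e.apply_symm_apply (φ' y))⟩

variable {R S : Type u} [CommRing R] [CommRing S] [Algebra R S] {x : R}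
  {G G' : Type u} [AddCommGroup G] [Module R G]
  [AddCommGroup G'] [Module R G'] [Module S G'] [IsScalarTower R S G'] {πG : G →ₗ[R] G'}

lemma isSMulRegular_dual (hxR : IsSMulRegular R x) : IsSMulRegular (Module.Dual R G) x := by
  intro a b hab
  ext g
  exact hxR (LinearMap.congr_fun hab g)

lemma isSMulRegular_of_isReflexive (hxR : IsSMulRegular R x) [Module.IsReflexive R G] :
    IsSMulRegular G x := by
  intro a b hab
  apply (Module.bijective_dual_eval R G).1
  apply isSMulRegular_dual hxR
  simpa using congrArg (Module.Dual.eval R G) hab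

namespace IsReductionMod

lemma exists_dual_lift (hS : IsReductionMod x (Algebra.linearMap R S)) (hxR : IsSMulRegular R x)
    (hE : Subsingleton (extMod R 1 G R)) (φ : G →ₗ[R] S) :
    ∃ ψ : G →ₗ[R] R, ∀ g, algebraMap R S (ψ g) = φ g := by
  obtain ⟨ψ, hψ⟩ := extMod_lifts (f := LinearMap.lsmul R R x) hxR hS.exact hS.surjective hE φ
  exact ⟨ψ, LinearMap.congr_fun hψ⟩

lemma exists_dual (hS : IsReductionMod x (Algebra.linearMap R S)) (hxR : IsSMulRegular R x)
    (hG : IsReductionMod x πG) (hE : Subsingleton (extMod R 1 G R)) :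
    ∃ δ : Module.Dual R G →ₗ[R] Module.Dual S G', IsReductionMod x δ ∧
      ∀ φ g, δ φ (πG g) = algebraMap R S (φ g) := by
  have H (φ : Module.Dual R G) := hS.exists_lift hG (Algebra.linearMap R S ∘ₗ φ)
  choose δ hδ using H
  refine ⟨{ toFun := δ, map_add' := fun a b ↦ ?_, map_smul' := fun r a ↦ ?_ },
    ⟨fun ψ ↦ ?_, fun φ ↦ ⟨fun h ↦ ?_, ?_⟩⟩, hδ⟩
  · apply hG.linearMap_ext
    simp [hδ]
  · apply hG.linearMap_ext
    simp [hδ, Algebra.smul_def]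
  · obtain ⟨φ, hφ⟩ := hS.exists_dual_lift hxR hE (ψ.restrictScalars R ∘ₗ πG)
    refine ⟨φ, hG.linearMap_ext fun g ↦ ?_⟩
    simpa [hδ] using hφ g
  · obtain ⟨ψ, hψ⟩ := hS.exact.exists_linearMap_comp_eq hxR φ fun g ↦ by
      have := hδ φ g
      rw [show δ φ = 0 from h] at this
      simpa using this.symm
    exact ⟨ψ, LinearMap.ext hψ⟩
  · rintro ⟨ψ, rfl⟩
    apply hG.linearMap_ext
    intro g
    simpa [hδ] using hS.smul_eq_zero (algebraMap R S (ψ g))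

end IsReductionMod

lemma subsingleton_extMod_reduction (hS : IsReductionMod x (Algebra.linearMap R S))
    (hxR : IsSMulRegular R x) (i : ℕ) :
    ∀ {G G' : Type u} [AddCommGroup G] [Module R G] [AddCommGroup G'] [Module R G'] [Module S G']
      [IsScalarTower R S G'] {πG : G →ₗ[R] G'}, IsReductionMod x πG → IsSMulRegular G x →
      (∀ j, 1 ≤ j → Subsingleton (extMod R j G R)) → Subsingleton (extMod S (i + 1) G' S) := by
  induction i with
  | zero =>
    intro G G' _ _ _ _ _ _ πG hG hxG hE
    obtain ⟨P, F, P', F', _, _, _, _, _, _, _, _, _, _, _, _, f, g, f', g', πP, πF, _, _, hP, hF,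
      hxP, hxF, hf, h, hg, hf', h', hg', hc, -⟩ := hS.exists_free_cover hG hxR hxG
    refine extMod_one_of_extends hf' h' hg' (extMod_of_projective 0) fun φ ↦ ?_
    obtain ⟨χ, hχ⟩ := hS.exists_dual_lift hxR
      (extMod_left hf h hg 0 (extMod_of_projective 0) (hE 2 (by omega)))
      (φ.restrictScalars R ∘ₗ πP)
    obtain ⟨ψ, hψ⟩ := extMod_extends hf h hg (hE 1 le_rfl) χ
    obtain ⟨Ψ, hΨ⟩ := hS.exists_lift hF (Algebra.linearMap R S ∘ₗ ψ)
    refine ⟨Ψ, hP.linearMap_ext fun k ↦ ?_⟩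
    have := LinearMap.congr_fun hψ k
    simp only [LinearMap.comp_apply] at this ⊢
    rw [hc, hΨ]
    simpa [this] using hχ k
  | succ i ih =>
    intro G G' _ _ _ _ _ _ πG hG hxG hE
    obtain ⟨P, F, P', F', _, _, _, _, _, _, _, _, _, _, _, _, f, g, f', g', πP, πF, _, _, hP, hF,
      hxP, hxF, hf, h, hg, hf', h', hg', hc, -⟩ := hS.exists_free_cover hG hxR hxG
    refine extMod_succ_right hf' h' hg' i (ih hP hxP ?_) (extMod_of_projective _)
    rintro (_ | j) hj
    · omega
    · exact extMod_left hf h hg j (extMod_of_projective _) (hE _ (by omega))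

lemma TotReflexive.isSMulRegular (hxR : IsSMulRegular R x) (hG : TotReflexive R G) :
    IsSMulRegular G x :=
  have := hG.2.1
  isSMulRegular_of_isReflexive hxR

lemma TotReflexive.reduction (hS : IsReductionMod x (Algebra.linearMap R S))
    (hxR : IsSMulRegular R x) (hG : IsReductionMod x πG) (hT : TotReflexive R G) :
    TotReflexive S G' := by
  have hxG := hT.isSMulRegular hxR
  obtain ⟨_, hrefl, hE, hE'⟩ := hT
  obtain ⟨δ, hδ, hδ'⟩ := hS.exists_dual hxR hG (hE 1 le_rfl)
  obtain ⟨ε, hε, hε'⟩ := hS.exists_dual hxR hδ (hE' 1 le_rfl)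
  have key (g : G) : Module.Dual.eval S G' (πG g) = ε (Module.Dual.eval R G g) := by
    apply hδ.linearMap_ext
    intro φ
    rw [hε', Module.Dual.eval_apply, Module.Dual.eval_apply, hδ']
  refine ⟨?_, ⟨?_, ?_⟩, ?_, ?_⟩
  · have := Module.Finite.of_surjective πG hG.surjective
    exact Module.Finite.of_restrictScalars_finite R S G'
  · rw [injective_iff_map_eq_zero]
    intro y hy
    obtain ⟨g, rfl⟩ := hG.surjective y
    rw [key] at hy
    obtain ⟨Φ, hΦ⟩ := (hε.eq_zero_iff _).1 hy
    obtain ⟨h, rfl⟩ := (Module.bijective_dual_eval R G).2 Φ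
    rw [← map_smul] at hΦ
    rw [← (Module.bijective_dual_eval R G).1 hΦ]
    exact hG.map_smul_eq_zero h
  · intro Ψ
    obtain ⟨Φ, rfl⟩ := hε.surjective Ψ
    obtain ⟨g, rfl⟩ := (Module.bijective_dual_eval R G).2 Φ
    exact ⟨πG g, key g⟩
  · rintro (_ | i) hi
    · omega
    · exact subsingleton_extMod_reduction hS hxR i hG hxG hE
  · rintro (_ | i) hi
    · omega
    · exact subsingleton_extMod_reduction hS hxR i hδ (isSMulRegular_dual hxR) hE'

end TotReflexiveReduction

section TotReflexiveSequences

variable {R : Type u} [CommRing R]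
  {A B C N : Type u} [AddCommGroup A] [Module R A] [AddCommGroup B] [Module R B]
  [AddCommGroup C] [Module R C] [AddCommGroup N] [Module R N]

lemma extMod_prod_of_projective [Module.Projective R B] (i : ℕ)
    (hA : Subsingleton (extMod R (i + 1) A N)) : Subsingleton (extMod R (i + 1) (A × B) N) :=
  extMod_middle (f := LinearMap.inl R A B) (g := LinearMap.snd R A B) LinearMap.inl_injective
    (by intro y; simp [Prod.ext_iff, eq_comm]) LinearMap.snd_surjective i hA
    (extMod_of_projective i)

lemma totReflexive_of_projective [Module.Finite R A] [Module.Projective R A] :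
    TotReflexive R A := by
  refine ⟨inferInstance, inferInstance, ?_, ?_⟩
  all_goals
    rintro (_ | i) hi
    · omega
    · exact extMod_of_projective i

lemma TotReflexive.prod [Module.Finite R B] [Module.Projective R B] (hA : TotReflexive R A) :
    TotReflexive R (A × B) := by
  obtain ⟨_, _, hE, hE'⟩ := hA
  refine ⟨inferInstance, inferInstance, ?_, ?_⟩
  all_goals rintro (_ | i) hi
  · omega
  · exact extMod_prod_of_projective i (hE _ hi)
  · omega
  · exact extMod_congr (LinearMap.coprodEquiv R) _
      (extMod_prod_of_projective (A := Module.Dual R A) (B := Module.Dual R B) i (hE' _ hi))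

lemma TotReflexive.ker [IsNoetherianRing R] {f : A →ₗ[R] B} {g : B →ₗ[R] C}
    (hf : Function.Injective f) (h : Function.Exact f g) (hg : Function.Surjective g)
    (hB : TotReflexive R B) (hC : TotReflexive R C) : TotReflexive R A := by
  obtain ⟨_, hBr, hBE, hBE'⟩ := hB
  obtain ⟨_, hCr, hCE, hCE'⟩ := hC
  have hBr := Module.bijective_dual_eval R B
  have hCr := Module.bijective_dual_eval R C
  have hgi : Function.Injective g.dualMap := LinearMap.dualMap_injective_of_surjective hg
  have hfs (φ : Module.Dual R A) : ∃ ψ : Module.Dual R B, ∀ a, ψ (f a) = φ a := by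
    obtain ⟨ψ, hψ⟩ := extMod_extends hf h hg (hCE 1 le_rfl) φ
    exact ⟨ψ, LinearMap.congr_fun hψ⟩
  have hfs' : Function.Surjective f.dualMap := fun φ ↦
    (hfs φ).imp fun ψ hψ ↦ LinearMap.ext hψ
  have hex : Function.Exact g.dualMap f.dualMap :=
    LinearMap.exact_lcomp_of_exact_of_surjective R h hg
  refine ⟨Module.Finite.of_injective f hf, ⟨?_, ?_⟩, ?_, ?_⟩
  · rw [injective_iff_map_eq_zero]
    intro a ha
    apply hf
    rw [map_zero]
    apply hBr.1
    ext φ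
    simpa using LinearMap.congr_fun ha (f.dualMap φ)
  · intro Φ
    obtain ⟨b, hb⟩ := hBr.2 (Φ ∘ₗ f.dualMap)
    have hgb : g b = 0 := by
      apply hCr.1
      ext ψ
      have := LinearMap.congr_fun hb (g.dualMap ψ)
      simp only [LinearMap.comp_apply, hex.apply_apply_eq_zero] at this
      simpa using this
    obtain ⟨a, rfl⟩ := (h b).1 hgb
    refine ⟨a, ?_⟩
    ext φ
    obtain ⟨ψ, rfl⟩ := hfs' φ
    exact LinearMap.congr_fun hb ψ
  · rintro (_ | i) hi
    · omega
    · exact extMod_left hf h hg i (hBE _ hi) (hCE _ (by omega))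
  · rintro (_ | _ | i) hi
    · omega
    · refine extMod_one_of_extends hgi hex hfs' (hBE' 1 le_rfl) fun Φ ↦ ?_
      obtain ⟨c, rfl⟩ := hCr.2 Φ
      obtain ⟨b, rfl⟩ := hg c
      exact ⟨Module.Dual.eval R B b, rfl⟩
    · exact extMod_succ_right hgi hex hfs' i (hCE' _ (by omega)) (hBE' _ (by omega))

end TotReflexiveSequences

section GdimLESequences

variable {R : Type u} [CommRing R] {A B C F : Type u} [AddCommGroup A] [Module R A]
  [AddCommGroup B] [Module R B] [AddCommGroup C] [Module R C] [AddCommGroup F] [Module R F]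

lemma GdimLE.ker [IsNoetherianRing R] {f : A →ₗ[R] B} {g : B →ₗ[R] C} {n : ℕ}
    (hf : Function.Injective f) (h : Function.Exact f g) (hg : Function.Surjective g)
    (hB : GdimLE R n (ModuleCat.of R B)) (hC : TotReflexive R C) :
    GdimLE R n (ModuleCat.of R A) := by
  cases hB with
  | zero _ hB => exact .zero _ (hB.ker hf h hg hC)
  | succ n _ K G hG i p hi hip hp hK =>
    let p' : G →ₗ[R] B := p.hom
    let i' : K →ₗ[R] G := i.hom
    have hgp : Function.Surjective (g ∘ₗ p') := hg.comp hp
    have hG' := hG.ker (Submodule.subtype_injective _) (g ∘ₗ p').exact_subtype_ker_map hgp hC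
    obtain ⟨q, hq⟩ := h.exists_linearMap_comp_eq hf (p' ∘ₗ (LinearMap.ker (g ∘ₗ p')).subtype)
      fun y ↦ y.2
    let j : K →ₗ[R] LinearMap.ker (g ∘ₗ p') := i'.codRestrict _ fun k ↦ by
      rw [LinearMap.mem_ker, LinearMap.comp_apply,
        show p' (i' k) = 0 from hip.apply_apply_eq_zero k, map_zero]
    refine .succ n _ K (ModuleCat.of R (LinearMap.ker (g ∘ₗ p'))) hG' (ModuleCat.ofHom j)
      (ModuleCat.ofHom q) ?_ ?_ ?_ hK
    · intro a b hab
      exact hi (congrArg Subtype.val hab)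
    · intro y
      change q y = 0 ↔ ∃ k, j k = y
      rw [← map_eq_zero_iff f hf, hq]
      refine (hip y.1).trans ⟨fun ⟨k, hk⟩ ↦ ⟨k, Subtype.ext hk⟩,
        fun ⟨k, hk⟩ ↦ ⟨k, congrArg Subtype.val hk⟩⟩
    · intro a
      obtain ⟨y, hy⟩ := hp (f a)
      have hy' : p' y = f a := hy
      refine ⟨⟨y, ?_⟩, hf ?_⟩
      · rw [LinearMap.mem_ker, LinearMap.comp_apply, hy', h.apply_apply_eq_zero]
      · exact (hq _).trans hy'

lemma GdimLE.prod [Module.Finite R B] [Module.Projective R B] {n : ℕ}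
    (hA : GdimLE R n (ModuleCat.of R A)) : GdimLE R n (ModuleCat.of R (A × B)) := by
  cases hA with
  | zero _ hA => exact .zero _ hA.prod
  | succ n _ K G hG i p hi hip hp hK =>
    refine .succ n _ K (ModuleCat.of R (G × B)) hG.prod
      (ModuleCat.ofHom (LinearMap.inl R G B ∘ₗ i.hom))
      (ModuleCat.ofHom (p.hom.prodMap (LinearMap.id : B →ₗ[R] B))) ?_ ?_ ?_ hK
    · exact LinearMap.inl_injective.comp hi
    · rintro ⟨y, b⟩
      change (p.hom y, b) = 0 ↔ ∃ k, (i.hom k, 0) = (y, b)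
      simp only [Prod.ext_iff, Prod.fst_zero, Prod.snd_zero]
      refine ⟨fun ⟨h1, h2⟩ ↦ ?_, fun ⟨k, h1, h2⟩ ↦ ⟨(hip y).2 ⟨k, h1⟩, h2.symm⟩⟩
      obtain ⟨k, hk⟩ := (hip y).1 h1
      exact ⟨k, hk, h2.symm⟩
    · exact hp.prodMap Function.surjective_id

lemma GdimLE.syzygy [IsNoetherianRing R] [Module.Finite R F] [Module.Projective R F]
    {f : A →ₗ[R] F} {g : F →ₗ[R] C} {n : ℕ} (hf : Function.Injective f)
    (h : Function.Exact f g) (hg : Function.Surjective g) (hC : GdimLE R n (ModuleCat.of R C)) :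
    ∃ m, GdimLE R m (ModuleCat.of R A) := by
  cases hC with
  | zero _ hC => exact ⟨0, .zero _ (totReflexive_of_projective.ker hf h hg hC)⟩
  | succ n _ K G hG i p hi hip hp hK =>
    let p' : G →ₗ[R] C := p.hom
    let i' : K →ₗ[R] G := i.hom
    have hip' : Function.Exact i' p' := hip
    obtain ⟨s, hs⟩ := Module.projective_lifting_property p' g hp
    obtain ⟨t, ht⟩ := hip'.exists_linearMap_comp_eq hi (s ∘ₗ f) fun a ↦ by
      have := LinearMap.congr_fun hs (f a)
      rw [h.apply_apply_eq_zero] at this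
      exact this
    have hs' (y : F) : p' (s y) = g y := LinearMap.congr_fun hs y
    refine ⟨n, GdimLE.ker (B := K × F) (C := G) (f := t.prod f) (g := s.comp (LinearMap.snd R K F) -
      i'.comp (LinearMap.fst R K F)) ?_ ?_ ?_ (GdimLE.prod (A := K) hK) hG⟩
    · intro a b hab
      exact hf (congrArg Prod.snd hab)
    · rintro ⟨k, y⟩
      simp only [LinearMap.sub_apply, LinearMap.comp_apply, LinearMap.snd_apply,
        LinearMap.fst_apply, sub_eq_zero]
      constructor
      · intro hk
        obtain ⟨a, rfl⟩ := (h y).1 (by rw [← hs', hk, hip'.apply_apply_eq_zero])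
        exact ⟨a, Prod.ext (hi ((ht a).trans hk)) rfl⟩
      · rintro ⟨a, ha⟩
        obtain ⟨rfl, rfl⟩ := Prod.ext_iff.1 ha
        exact (ht a).symm
    · intro z
      obtain ⟨y, hy⟩ := hg (p' z)
      obtain ⟨k, hk⟩ := (hip' (s y - z)).1 (by rw [map_sub, hs', hy, sub_self])
      exact ⟨(k, y), by simp [hk]⟩

end GdimLESequences

section GdimLEReduction

open TensorProduct

variable {R S : Type u} [CommRing R] [CommRing S] [Algebra R S] {x : R}

lemma IsReductionMod.baseChange (hS : IsReductionMod x (Algebra.linearMap R S))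
    (G : Type u) [AddCommGroup G] [Module R G] : IsReductionMod x (TensorProduct.mk R S G 1) := by
  have key (r : R) (g : G) : (1 : S) ⊗ₜ[R] (r • g) = algebraMap R S r ⊗ₜ[R] g := by
    rw [TensorProduct.tmul_smul, TensorProduct.smul_tmul', Algebra.smul_def, mul_one]
  refine ⟨fun z ↦ ?_, fun g ↦ ⟨fun h ↦ ?_, ?_⟩⟩
  · induction z with
    | zero => exact ⟨0, map_zero _⟩
    | add a b ha hb =>
      obtain ⟨a, rfl⟩ := ha
      obtain ⟨b, rfl⟩ := hb
      exact ⟨a + b, map_add _ _ _⟩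
    | tmul s g =>
      obtain ⟨r, rfl⟩ := hS.surjective s
      exact ⟨r • g, key r g⟩
  · have hex := rTensor_exact G hS.exact hS.surjective
    obtain ⟨t, ht⟩ := (hex (1 ⊗ₜ g)).1 (by simpa using h)
    obtain ⟨y, rfl⟩ := (TensorProduct.lid R G).symm.surjective t
    refine ⟨y, ?_⟩
    have := congrArg (TensorProduct.lid R G) ht
    rwa [TensorProduct.lid_symm_apply, LinearMap.rTensor_tmul, TensorProduct.lid_tmul,
      TensorProduct.lid_tmul, one_smul, LinearMap.lsmul_apply, smul_eq_mul, mul_one] at this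
  · rintro ⟨y, rfl⟩
    rw [TensorProduct.mk_apply, key, hS.algebraMap_self, zero_tmul]

lemma GdimLE.reduction (hS : IsReductionMod x (Algebra.linearMap R S))
    (hxR : IsSMulRegular R x) {n : ℕ} {M : ModuleCat.{u} R} (hM : GdimLE R n M) :
    ∀ {M' : Type u} [AddCommGroup M'] [Module R M'] [Module S M'] [IsScalarTower R S M']
      {π : M →ₗ[R] M'}, IsReductionMod x π → IsSMulRegular M x →
      GdimLE S n (ModuleCat.of S M') := by
  induction hM with
  | zero M hM => exact fun hπ _ ↦ .zero _ (hM.reduction hS hxR hπ)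
  | succ n M K G hG i p hi hip hp hK ih =>
    intro M' _ _ _ _ π hπ hxM
    have hG' := hS.baseChange G
    obtain ⟨q, hq⟩ := hS.exists_lift hG' (π ∘ₗ p.hom)
    have hxG := hG.isSMulRegular hxR
    have hxK : IsSMulRegular K x := by
      intro a b hab
      apply hi
      apply hxG
      have := congrArg i.hom hab
      simpa only [map_smul] using this
    obtain ⟨πK, hπK, -⟩ := IsReductionMod.exists_ker (f := i.hom) (g := p.hom)
      (K' := LinearMap.ker q) hG' hπ hxM hi hip hp
      (Submodule.subtype_injective (LinearMap.ker q)) q.exact_subtype_ker_map hq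
    have hqs : Function.Surjective q := by
      intro z
      obtain ⟨w, rfl⟩ := hπ.surjective z
      obtain ⟨y, rfl⟩ := hp w
      exact ⟨_, hq y⟩
    exact .succ n _ (ModuleCat.of S (LinearMap.ker q)) (ModuleCat.of S (S ⊗[R] G))
      (hG.reduction hS hxR hG') (ModuleCat.ofHom (LinearMap.ker q).subtype) (ModuleCat.ofHom q)
      (Submodule.subtype_injective _) q.exact_subtype_ker_map hqs (ih hπK hxK)

end GdimLEReduction

section Depth

open IsLocalRing

variable {R : Type u} [CommRing R] [IsLocalRing R] {M : Type u} [AddCommGroup M] [Module R M]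

lemma nontrivial_extMod_zero_residueField_iff :
    Nontrivial (extMod R 0 (ResidueField R) M) ↔
      ∃ m : M, m ≠ 0 ∧ ∀ t ∈ maximalIdeal R, t • m = 0 := by
  rw [← not_subsingleton_iff_nontrivial, subsingleton_extMod_zero_iff_hom,
    not_subsingleton_iff_nontrivial]
  constructor
  · intro _
    obtain ⟨φ, hφ⟩ := exists_ne (0 : ResidueField R →ₗ[R] M)
    refine ⟨φ 1, fun h ↦ hφ ?_, fun t ht ↦ ?_⟩
    · ext z
      obtain ⟨r, rfl⟩ := residue_surjective z
      have : residue R r = r • (1 : ResidueField R) := by simp [Algebra.smul_def]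
      rw [this, map_smul, h, smul_zero]
      rfl
    · have : t • (1 : ResidueField R) = 0 := by
        rw [Algebra.smul_def, mul_one]
        exact (residue_eq_zero_iff t).2 ht
      rw [← map_smul, this, map_zero]
  · rintro ⟨m, hm, h⟩
    let φ : ResidueField R →ₗ[R] M :=
      (maximalIdeal R).liftQ (LinearMap.toSpanSingleton R M m) fun t ht ↦ by simpa using h t ht
    refine ⟨φ, 0, fun hφ ↦ hm ?_⟩
    have : φ (Submodule.Quotient.mk 1) = m :=
      ((maximalIdeal R).liftQ_apply _ _).trans (one_smul R m)
    rw [← this, hφ]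
    rfl

lemma eDepth_eq_zero_iff : eDepth R M = 0 ↔ ∃ m : M, m ≠ 0 ∧ ∀ t ∈ maximalIdeal R, t • m = 0 := by
  rw [← nontrivial_extMod_zero_residueField_iff]
  unfold eDepth
  rw [ENat.sInf_eq_zero]
  constructor
  · rintro ⟨i, hi, h⟩
    obtain rfl : i = 0 := by exact_mod_cast hi.symm
    exact h
  · exact fun h ↦ ⟨0, by simp, h⟩

lemma subsingleton_extMod_one_of_eDepth (h : 0 < eDepth R M) (h1 : eDepth R M ≠ 1) :
    Subsingleton (extMod R 1 (ResidueField R) M) := by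
  by_contra hne
  rw [not_subsingleton_iff_nontrivial] at hne
  refine h1 (le_antisymm (sInf_le ⟨1, by simp, hne⟩) ?_)
  exact Order.one_le_iff_pos.2 h

lemma exists_isSMulRegular_of_eDepth_pos [IsNoetherianRing R] (h : 0 < eDepth R R) :
    ∃ x ∈ maximalIdeal R, IsSMulRegular R x := by
  have hH : Subsingleton (ResidueField R →ₗ[R] R) := by
    rw [← subsingleton_extMod_zero_iff_hom, ← not_nontrivial_iff_subsingleton,
      nontrivial_extMod_zero_residueField_iff, ← eDepth_eq_zero_iff]
    exact h.ne'
  have : Module.Finite R (ResidueField R) := Module.Finite.of_surjective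
    (Algebra.linearMap R (ResidueField R)) residue_surjective
  obtain ⟨x, hx, hreg⟩ := IsSMulRegular.subsingleton_linearMap_iff.1 hH
  refine ⟨x, (residue_eq_zero_iff x).1 ?_, hreg⟩
  simpa [Algebra.smul_def] using Module.mem_annihilator.1 hx 1

end Depth

section DepthReduction

open IsLocalRing TensorProduct

variable {R S : Type u} [CommRing R] [CommRing S] [IsLocalRing R] [IsLocalRing S] [Algebra R S]
  {x : R}

lemma IsReductionMod.exists_mem_maximalIdeal (hS : IsReductionMod x (Algebra.linearMap R S))
    {s : S} (hs : s ∈ maximalIdeal S) : ∃ t ∈ maximalIdeal R, algebraMap R S t = s := by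
  obtain ⟨t, rfl⟩ := hS.surjective s
  exact ⟨t, fun ht ↦ hs (ht.map (algebraMap R S)), rfl⟩

lemma IsReductionMod.algebraMap_mem_maximalIdeal
    (hS : IsReductionMod x (Algebra.linearMap R S)) {t : R} (ht : t ∈ maximalIdeal R) :
    algebraMap R S t ∈ maximalIdeal S := by
  have := IsLocalHom.of_surjective (algebraMap R S) hS.surjective
  exact fun h ↦ ht (isUnit_of_map_unit _ _ h)

lemma IsReductionMod.eDepth_pos (hS : IsReductionMod x (Algebra.linearMap R S))
    (hxR : IsSMulRegular R x) (hx : x ∈ maximalIdeal R)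
    (hE : Subsingleton (extMod R 1 (ResidueField R) R)) : 0 < eDepth S S := by
  rw [pos_iff_ne_zero, Ne, eDepth_eq_zero_iff]
  rintro ⟨s, hs, h⟩
  obtain ⟨a, rfl⟩ := hS.surjective s
  let i : maximalIdeal R →ₗ[R] R := Submodule.subtype (maximalIdeal R)
  obtain ⟨φ, hφ⟩ := hS.exact.exists_linearMap_comp_eq hxR
    (LinearMap.toSpanSingleton R R a ∘ₗ i) fun t ↦ by
      simpa [i] using h _ (hS.algebraMap_mem_maximalIdeal t.2)
  have hi : Function.Exact i (Algebra.linearMap R (ResidueField R)) := by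
    intro r
    refine (residue_eq_zero_iff r).trans ?_
    simp [i]
  obtain ⟨ψ, hψ⟩ := extMod_extends (Submodule.subtype_injective _) hi residue_surjective hE φ
  have h1 : φ ⟨x, hx⟩ = a := hxR (hφ ⟨x, hx⟩)
  have h2 : ψ x = φ ⟨x, hx⟩ := LinearMap.congr_fun hψ ⟨x, hx⟩
  refine hs ((hS.eq_zero_iff a).2 ⟨ψ 1, ?_⟩)
  rw [← map_smul, smul_eq_mul, mul_one, h2, h1]

variable {K F M K' : Type u} [AddCommGroup K] [Module R K] [AddCommGroup F] [Module R F]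
  [AddCommGroup M] [Module R M] [AddCommGroup K'] [Module R K'] [Module S K']
  [IsScalarTower R S K']

lemma IsReductionMod.eDepth_eq_zero_of_syzygy (hS : IsReductionMod x (Algebra.linearMap R S))
    (hx : x ∈ maximalIdeal R) {f : K →ₗ[R] F} {g : F →ₗ[R] M} (hf : Function.Injective f)
    (h : Function.Exact f g) (hg : Function.Surjective g) (hxF : IsSMulRegular F x)
    {π : K →ₗ[R] K'} (hπ : IsReductionMod x π) (hM : eDepth R M = 0) : eDepth S K' = 0 := by
  obtain ⟨m, hm, h0⟩ := eDepth_eq_zero_iff.1 hM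
  obtain ⟨y, rfl⟩ := hg m
  have lift {t : R} (ht : t ∈ maximalIdeal R) : ∃ k, f k = t • y :=
    (h _).1 (by rw [map_smul, h0 t ht])
  obtain ⟨k, hk⟩ := lift hx
  refine eDepth_eq_zero_iff.2 ⟨π k, fun hπk ↦ hm ?_, fun s hs ↦ ?_⟩
  · obtain ⟨k₁, rfl⟩ := (hπ.eq_zero_iff k).1 hπk
    rw [map_smul] at hk
    rw [← hxF hk, h.apply_apply_eq_zero]
  · obtain ⟨t, ht, rfl⟩ := hS.exists_mem_maximalIdeal hs
    obtain ⟨k₂, hk₂⟩ := lift ht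
    rw [algebraMap_smul, ← map_smul]
    refine (hπ.eq_zero_iff _).2 ⟨k₂, hf ?_⟩
    rw [map_smul, map_smul, hk₂, hk, smul_comm]

end DepthReduction

section TorIndependentPairs

open IsLocalRing TensorProduct

lemma gdim_ne_top_iff {R : Type u} [CommRing R] {M : ModuleCat.{u} R} :
    gdim R M ≠ ⊤ ↔ ∃ n, GdimLE R n M := by
  constructor
  · intro h
    by_contra! hne
    exact h (sInf_eq_top.2 fun a ⟨n, _, hn⟩ ↦ (hne n hn).elim)
  · rintro ⟨n, hn⟩
    exact ne_top_of_le_ne_top (ENat.natCast_ne_top n) (sInf_le ⟨n, rfl, hn⟩)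

lemma exists_finite_free_presentation (R : Type u) [CommRing R] [IsNoetherianRing R] (N : Type u)
    [AddCommGroup N] [Module R N] [Module.Finite R N] :
    ∃ (L E : Type u) (_ : AddCommGroup L) (_ : Module R L) (_ : AddCommGroup E) (_ : Module R E)
      (f : L →ₗ[R] E) (g : E →ₗ[R] N), Module.Finite R L ∧ Module.Free R E ∧ Module.Finite R E ∧
        Function.Injective f ∧ Function.Exact f g ∧ Function.Surjective g := by
  obtain ⟨n, g, hg⟩ := Module.Finite.exists_fin' R N
  exact ⟨LinearMap.ker g, Fin n → R, inferInstance, inferInstance, inferInstance, inferInstance,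
    (LinearMap.ker g).subtype, g, inferInstance, inferInstance, inferInstance,
    Submodule.subtype_injective _, g.exact_subtype_ker_map, hg⟩

lemma isSMulRegular_of_flat {R F : Type u} [CommRing R] [AddCommGroup F] [Module R F]
    [Module.Flat R F] {x : R} (hx : IsSMulRegular R x) : IsSMulRegular F x :=
  ((TensorProduct.rid R F).isSMulRegular_congr x).1 (hx.lTensor F)

lemma isReductionMod_quotient_span_singleton {R : Type u} [CommRing R] (x : R) :
    IsReductionMod x (Algebra.linearMap R (R ⧸ Ideal.span {x})) := by
  refine ⟨Ideal.Quotient.mk_surjective, fun r ↦ ?_⟩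
  refine Ideal.Quotient.eq_zero_iff_mem.trans (Ideal.mem_span_singleton'.trans ?_)
  simp [mul_comm]

lemma ringKrullDim_quotient_lt {R : Type u} [CommRing R] {x : R} (hx : IsSMulRegular R x) {n : ℕ}
    (h : ringKrullDim R < (n + 1 : ℕ)) : ringKrullDim (R ⧸ Ideal.span {x}) < n := by
  by_contra! hn
  have h1 := ringKrullDim_quotient_succ_le_of_nonZeroDivisor
    (r := x) (mem_nonZeroDivisors_iff_right.2 fun z hz ↦
      hx (by simpa [mul_comm] using hz))
  have h2 : (n : WithBot ℕ∞) + 1 ≤ ringKrullDim (R ⧸ Ideal.span {x}) + 1 := by gcongr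
  exact absurd (h2.trans h1) (not_le.2 (by exact_mod_cast h))

lemma not_torIndep_of_eDepth_eq_zero
    (H : ∀ (S : Type u) [CommRing S] [IsNoetherianRing S] [IsLocalRing S],
      eDepth S S = 1 →
      ∀ (A B : Type u) [AddCommGroup A] [Module S A] [AddCommGroup B] [Module S B],
        Module.Finite S A → Module.Finite S B →
        gdim S (ModuleCat.of S A) ≠ ⊤ → gdim S (ModuleCat.of S B) ≠ ⊤ →
        TorIndep S A B → ¬(eDepth S A = 0 ∧ eDepth S B = 0)) (n : ℕ) :
    ∀ (R : Type u) [CommRing R] [IsNoetherianRing R] [IsLocalRing R],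
      ringKrullDim R < n → 0 < eDepth R R →
      ∀ (M N : Type u) [AddCommGroup M] [Module R M] [AddCommGroup N] [Module R N]
        [Module.Finite R M] [Module.Finite R N],
        (∃ i, GdimLE R i (ModuleCat.of R M)) → (∃ i, GdimLE R i (ModuleCat.of R N)) →
        eDepth R M = 0 → eDepth R N = 0 → ¬ TorIndep R M N := by
  induction n with
  | zero =>
    intro R _ _ _ hdim
    exact absurd hdim (not_lt.2 ringKrullDim_nonneg_of_nontrivial)
  | succ n ih =>
    intro R _ _ _ hdim hd M N _ _ _ _ _ _ ⟨a, hM⟩ ⟨b, hN⟩ h0M h0N hT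
    by_cases hd1 : eDepth R R = 1
    · exact H R hd1 M N inferInstance inferInstance (gdim_ne_top_iff.2 ⟨a, hM⟩)
        (gdim_ne_top_iff.2 ⟨b, hN⟩) hT ⟨h0M, h0N⟩
    obtain ⟨x, hx, hxR⟩ := exists_isSMulRegular_of_eDepth_pos hd
    have : Nontrivial (R ⧸ Ideal.span {x}) := Ideal.Quotient.nontrivial_iff.2 fun h ↦
      hx (Ideal.span_singleton_eq_top.1 h)
    have : IsLocalRing (R ⧸ Ideal.span {x}) :=
      .of_surjective' (Ideal.Quotient.mk _) Ideal.Quotient.mk_surjective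
    have hS := isReductionMod_quotient_span_singleton x
    obtain ⟨K, F, _, _, _, _, f, g, _, _, _, hf, h, hg⟩ := exists_finite_free_presentation R M
    obtain ⟨L, E, _, _, _, _, f', g', _, _, _, hf', h', hg'⟩ :=
      exists_finite_free_presentation R N
    have hxF : IsSMulRegular F x := isSMulRegular_of_flat hxR
    have hxE : IsSMulRegular E x := isSMulRegular_of_flat hxR
    have hxK : IsSMulRegular K x := hxF.of_injective f hf
    have hxL : IsSMulRegular L x := hxE.of_injective f' hf'
    have hK := hS.baseChange K
    have hL := hS.baseChange L
    obtain ⟨c, hKG⟩ := hM.syzygy hf h hg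
    obtain ⟨d, hLG⟩ := hN.syzygy hf' h' hg'
    exact ih (R ⧸ Ideal.span {x}) (ringKrullDim_quotient_lt hxR hdim)
      (hS.eDepth_pos hxR hx (subsingleton_extMod_one_of_eDepth hd hd1))
      ((R ⧸ Ideal.span {x}) ⊗[R] K) ((R ⧸ Ideal.span {x}) ⊗[R] L)
      ⟨c, hKG.reduction hS hxR hK hxK⟩ ⟨d, hLG.reduction hS hxR hL hxL⟩
      (hS.eDepth_eq_zero_of_syzygy hx hf h hg hxF hK h0M)
      (hS.eDepth_eq_zero_of_syzygy hx hf' h' hg' hxE hL h0N)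
      (((hT.syzygy_left hf h hg).syzygy_right hf' h' hg').reduction hS hxR hxK hK hL hxL
        (hT.isSMulRegular_tensor_syzygy hf h hg hf' h' hg' hxR))

end TorIndependentPairs

/-- if over every depth-one Noetherian local ring there is no
Tor-independent pair of finite-G-dimension modules both of depth `0`, then over any
Noetherian local ring of positive depth, Tor-independent `M`, `N` of finite
G-dimension with `depth M = depth N = 0` force `M = 0` or `N = 0`. -/
theorem stmt_17
    (H : ∀ (S : Type u) [CommRing S] [IsNoetherianRing S] [IsLocalRing S],
      eDepth S S = 1 →
      ∀ (A B : Type u) [AddCommGroup A] [Module S A] [AddCommGroup B] [Module S B],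
        Module.Finite S A → Module.Finite S B →
        gdim S (ModuleCat.of S A) ≠ ⊤ → gdim S (ModuleCat.of S B) ≠ ⊤ →
        TorIndep S A B → ¬(eDepth S A = 0 ∧ eDepth S B = 0))
    (R : Type u) [CommRing R] [IsNoetherianRing R] [IsLocalRing R]
    (hd : 0 < eDepth R R)
    (M N : Type u) [AddCommGroup M] [Module R M] [AddCommGroup N] [Module R N]
    [Module.Finite R M] [Module.Finite R N]
    (hTI : TorIndep R M N)
    (hgM : gdim R (ModuleCat.of R M) ≠ ⊤) (hgN : gdim R (ModuleCat.of R N) ≠ ⊤)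
    (h0M : eDepth R M = 0) (h0N : eDepth R N = 0) :
    Subsingleton M ∨ Subsingleton N := by
  obtain ⟨d, hd'⟩ := WithBot.ne_bot_iff_exists.1 (ringKrullDim_ne_bot (R := R))
  obtain ⟨n, rfl⟩ := ENat.ne_top_iff_exists.1 (show d ≠ ⊤ from fun h ↦
    ringKrullDim_ne_top (R := R) (by rw [← hd', h]; rfl))
  have hdim : ringKrullDim R < (n + 1 : ℕ) := by
    rw [← hd']
    exact_mod_cast n.lt_succ_self
  exact (not_torIndep_of_eDepth_eq_zero H (n + 1) R hdim hd M N (gdim_ne_top_iff.1 hgM)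
    (gdim_ne_top_iff.1 hgN) h0M h0N hTI).elim
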